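/- Let n ≥ 2 and r ≥ 1 be integers, and for τ ∈ ℍ set B(n,0,…,0;τ) (with r zeros) = ((2πi)^r τⁿ / r!) · ∫₀¹ t^r ω_n(τt,τ) dt. Define the Laurent polynomial P(τ) = ((2πi)^{r+1} τⁿ / r!) · Σ_{k=0}^{n} B_k/(k!·(n−k)!·(n−k+r+1)) − Σ_{p=0}^{r−1} (1/(r−p)!) · binom(n+p−1, p) · (2πi)^{r+1−n−p} · ζ(n+p) · τ^{−p} − (1 + (−1)^{n+r}) · binom(n+r−1, r) · (2πi)^{1−n} · ζ(n+r) · τ^{−r}. Then there exist constants C, T > 0 such that |B(n,0,…,0;τ) − P(τ)| ≤ C·e^{−π·Im τ} for all τ ∈ ℍ with Im τ ≥ T and |Re τ| ≤ 1. -/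

import Mathlib

open scoped Real Nat
open Finset MeasureTheory

/-- The coefficients `f_n(ξ,τ)` of the expansion of the Kronecker function:
`f₀ = 2πi`, `f₁(ξ,τ) = π cot(πξ) − 2πi Σ_{m,p≥1}(e^{2πimξ} − e^{−2πimξ}) q^{mp}` and, for
`n ≥ 2`, `f_n(ξ,τ) = (2πi/(n−1)!)(Bₙ/n − Σ_{m,p≥1}(e^{2πimξ} + (−1)ⁿ e^{−2πimξ}) p^{n−1} q^{mp})`
(Bernoulli numbers with `B₁ = −1/2`). -/
noncomputable def fKr : ℕ → ℂ → ℂ → ℂ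
  | 0, _, _ => 2 * ↑π * Complex.I
  | 1, ξ, τ =>
      ↑π * Complex.cot (↑π * ξ) -
        2 * ↑π * Complex.I *
          ∑' mp : ℕ × ℕ,
            (Complex.exp (2 * ↑π * Complex.I * ((mp.1 : ℂ) + 1) * ξ) -
                Complex.exp (-(2 * ↑π * Complex.I * ((mp.1 : ℂ) + 1) * ξ))) *
              Complex.exp (2 * ↑π * Complex.I * τ) ^ ((mp.1 + 1) * (mp.2 + 1))
  | (n + 2), ξ, τ =>
      (2 * ↑π * Complex.I / ((n + 1)! : ℂ)) *
        ((bernoulli (n + 2) : ℂ) / ((n : ℂ) + 2) -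
          ∑' mp : ℕ × ℕ,
            (Complex.exp (2 * ↑π * Complex.I * ((mp.1 : ℂ) + 1) * ξ) +
                (-1 : ℂ) ^ (n + 2) *
                  Complex.exp (-(2 * ↑π * Complex.I * ((mp.1 : ℂ) + 1) * ξ))) *
              ((mp.2 : ℂ) + 1) ^ (n + 1) *
              Complex.exp (2 * ↑π * Complex.I * τ) ^ ((mp.1 + 1) * (mp.2 + 1)))

/-- `ω_n(ξ,τ) = Σ_{k=0}^{n} ((Im ξ/Im τ)^k / k!) · f_{n−k}(ξ,τ)`. -/
noncomputable def omKr (n : ℕ) (ξ τ : ℂ) : ℂ :=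
  ∑ k ∈ Finset.range (n + 1),
    (((ξ.im / τ.im) ^ k / (k ! : ℝ) : ℝ) : ℂ) * fKr (n - k) ξ τ

/-- The open simplex `{1 > t₁ > ⋯ > t_r > 0}` in `(Fin r → ℝ)`. -/
def openSimplex (r : ℕ) : Set (Fin r → ℝ) :=
  {t | (∀ i, 0 < t i ∧ t i < 1) ∧ ∀ i j : Fin r, i < j → t j < t i}

/-- The A-elliptic multiple zeta value
`A(n₁,…,n_r;τ) = ∫_{1>t₁>⋯>t_r>0} f_{n₁}(t₁,τ)⋯f_{n_r}(t_r,τ) dt`. -/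
noncomputable def Aell {r : ℕ} (n : Fin r → ℕ) (τ : ℂ) : ℂ :=
  ∫ t in openSimplex r, ∏ i, fKr (n i) ((t i : ℝ) : ℂ) τ

/-- The B-elliptic multiple zeta value
`B(n₁,…,n_r;τ) = τ^{n₁+⋯+n_r} ∫_{1>t₁>⋯>t_r>0} ω_{n₁}(τt₁,τ)⋯ω_{n_r}(τt_r,τ) dt`. -/
noncomputable def Bell {r : ℕ} (n : Fin r → ℕ) (τ : ℂ) : ℂ :=
  τ ^ (∑ i, n i) * ∫ t in openSimplex r, ∏ i, omKr (n i) (τ * ((t i : ℝ) : ℂ)) τ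

/-- The depth-one B-elliptic multiple zeta value `B(n,0,…,0;τ)` (with `r` zeros), in the form
`((2πi)^r τⁿ / r!) · ∫₀¹ t^r ω_n(τt,τ) dt`. -/
noncomputable def BellDepthOne (n r : ℕ) (τ : ℂ) : ℂ :=
  ((2 * ↑π * Complex.I) ^ r * τ ^ n / (r ! : ℂ)) *
    ∫ t in Set.Ioo (0 : ℝ) 1, ((t : ℝ) : ℂ) ^ r * omKr n (τ * ((t : ℝ) : ℂ)) τ

/-- The Laurent polynomial `P(τ)` giving the constant term of `B(n,0,…,0;τ)`. -/
noncomputable def laurentP (n r : ℕ) (τ : ℂ) : ℂ :=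
  ((2 * ↑π * Complex.I) ^ (r + 1) * τ ^ n / (r ! : ℂ)) *
      ∑ k ∈ Finset.range (n + 1),
        (bernoulli k : ℂ) / ((k ! : ℂ) * ((n - k)! : ℂ) * ((n - k + r + 1 : ℕ) : ℂ)) -
    ∑ p ∈ Finset.range r,
      (1 / ((r - p)! : ℂ)) * ((n + p - 1).choose p : ℂ) *
        (2 * ↑π * Complex.I) ^ ((r : ℤ) + 1 - (n : ℤ) - (p : ℤ)) *
        riemannZeta ((n + p : ℕ) : ℂ) * τ ^ (-(p : ℤ)) -
    (1 + (-1 : ℂ) ^ (n + r)) * ((n + r - 1).choose r : ℂ) *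
      (2 * ↑π * Complex.I) ^ (1 - (n : ℤ)) * riemannZeta ((n + r : ℕ) : ℂ) * τ ^ (-(r : ℤ))

lemma integral_pow_succ_mul_exp (a : ℕ) {z : ℂ} (hz : z ≠ 0) :
    ∫ s in (0 : ℝ)..1, (s : ℂ) ^ (a + 1) * Complex.exp (z * s) =
      Complex.exp z / z - (a + 1) / z * ∫ s in (0 : ℝ)..1, (s : ℂ) ^ a * Complex.exp (z * s) := by
  have hd : ∀ s : ℝ, HasDerivAt (fun s : ℝ => (s : ℂ) ^ (a + 1) * (Complex.exp (z * s) / z))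
      ((a + 1) / z * ((s : ℂ) ^ a * Complex.exp (z * s)) +
        (s : ℂ) ^ (a + 1) * Complex.exp (z * s)) s := by
    intro s
    have h0 : HasDerivAt (fun s : ℝ => (s : ℂ)) 1 s := Complex.ofRealCLM.hasDerivAt
    have h1 := h0.pow (a + 1)
    have h2 := ((h0.const_mul z).cexp).div_const z
    convert! h1.mul h2 using 1
    simp
    field_simp
  have h := intervalIntegral.integral_eq_sub_of_hasDerivAt (a := 0) (b := 1)
    (fun s _ => hd s) (by apply Continuous.intervalIntegrable; fun_prop)
  rw [intervalIntegral.integral_add (by apply Continuous.intervalIntegrable; fun_prop)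
    (by apply Continuous.intervalIntegrable; fun_prop), intervalIntegral.integral_const_mul] at h
  simp at h
  linear_combination h

lemma exists_norm_integral_pow_mul_exp_sub_le (a : ℕ) :
    ∃ K : ℝ, 0 ≤ K ∧ ∀ z : ℂ, 1 ≤ ‖z‖ →
      ‖(∫ s in (0 : ℝ)..1, (s : ℂ) ^ a * Complex.exp (z * s)) - (a ! : ℂ) / (-z) ^ (a + 1)‖ ≤
        K * Real.exp z.re := by
  induction a with
  | zero =>
    refine ⟨1, zero_le_one, fun z hz => ?_⟩
    have hz0 : z ≠ 0 := by rintro rfl; simp at hz; linarith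
    have h : (∫ s in (0 : ℝ)..1, (s : ℂ) ^ 0 * Complex.exp (z * s)) - (0 ! : ℂ) / (-z) ^ (0 + 1)
        = Complex.exp z / z := by
      simp only [pow_zero, one_mul]
      rw [integral_exp_mul_complex hz0]
      simp
      field_simp
      ring
    rw [h, norm_div, Complex.norm_exp, one_mul]
    exact div_le_self (Real.exp_pos _).le hz
  | succ a ih =>
    obtain ⟨K, hK, h⟩ := ih
    refine ⟨1 + (a + 1) * K, by positivity, fun z hz => ?_⟩
    have hz0 : z ≠ 0 := by rintro rfl; simp at hz; linarith
    rw [integral_pow_succ_mul_exp a hz0]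
    set J := ∫ s in (0 : ℝ)..1, (s : ℂ) ^ a * Complex.exp (z * s)
    have e : Complex.exp z / z - (a + 1) / z * J - ((a + 1)! : ℂ) / (-z) ^ (a + 1 + 1) =
        Complex.exp z / z - (a + 1) / z * (J - (a ! : ℂ) / (-z) ^ (a + 1)) := by
      rw [Nat.factorial_succ, pow_succ (-z) (a + 1)]
      push_cast
      field_simp
      ring
    rw [e]
    have hn : ‖((a : ℂ) + 1)‖ = (a : ℝ) + 1 := by exact_mod_cast Complex.norm_natCast (a + 1)
    calc _ ≤ ‖Complex.exp z / z‖ + ‖((a : ℂ) + 1) / z * (J - (a ! : ℂ) / (-z) ^ (a + 1))‖ :=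
          norm_sub_le _ _
      _ ≤ Real.exp z.re + (a + 1) * (K * Real.exp z.re) := by
          rw [norm_div, norm_mul, norm_div, Complex.norm_exp, hn]
          gcongr
          · exact div_le_self (Real.exp_pos _).le hz
          · exact div_le_self (by positivity) hz
          · exact h z hz
      _ = _ := by ring

/-- The moments of a decaying exponential over the unit interval decay quadratically. -/
lemma exists_integral_pow_mul_exp_neg_le {a : ℕ} (ha : 1 ≤ a) :
    ∃ K : ℝ, 0 ≤ K ∧ ∀ x : ℝ, 1 ≤ x →
      ∫ s in (0 : ℝ)..1, s ^ a * Real.exp (-(x * s)) ≤ K / x ^ 2 := by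
  obtain ⟨K, hK, h⟩ := exists_norm_integral_pow_mul_exp_sub_le a
  refine ⟨a ! + 2 * K, by positivity, fun x hx => ?_⟩
  have hx0 : 0 < x := by linarith
  have h1 := h (-(x : ℂ)) (by simpa [abs_of_pos hx0] using hx)
  have h2 : ((∫ s in (0 : ℝ)..1, s ^ a * Real.exp (-(x * s)) : ℝ) : ℂ) =
      ∫ s in (0 : ℝ)..1, (s : ℂ) ^ a * Complex.exp (-(x : ℂ) * s) := by
    rw [← intervalIntegral.integral_ofReal]
    congr 1; ext s; push_cast; ring_nf
  rw [← h2, neg_neg] at h1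
  have h3 : ((a ! : ℂ) / (x : ℂ) ^ (a + 1)) = ((a ! / x ^ (a + 1) : ℝ) : ℂ) := by push_cast; rfl
  rw [h3, ← Complex.ofReal_sub, Complex.norm_real] at h1
  have h4 := (le_abs_self _).trans h1
  have h5 : (a ! : ℝ) / x ^ (a + 1) ≤ a ! / x ^ 2 := by
    gcongr
    · omega
  have h6 : Real.exp (-x) ≤ 2 / x ^ 2 := by
    have := Real.pow_div_factorial_le_exp x hx0.le 2
    rw [Real.exp_neg, inv_eq_one_div, div_le_div_iff₀ (Real.exp_pos _) (by positivity)]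
    simp [Nat.factorial] at this
    linarith
  have h7 : K * Real.exp (-x) ≤ K * (2 / x ^ 2) := by gcongr
  simp only [Complex.neg_re, Complex.ofReal_re] at h4
  calc _ ≤ (a ! : ℝ) / x ^ 2 + K * (2 / x ^ 2) := by linarith
    _ = _ := by ring

lemma integral_add_tsum {ι α : Type*} [Countable ι] [MeasurableSpace α] {μ : Measure α}
    {P : α → ℂ} {F : ι → α → ℂ} (hP : Integrable P μ) (hF : ∀ i, Integrable (F i) μ)
    (hs : Summable fun i => ∫ t, ‖F i t‖ ∂μ) (hp : ∀ᵐ t ∂μ, Summable fun i => F i t) :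
    ∫ t, (P t + ∑' i, F i t) ∂μ = (∫ t, P t ∂μ) + ∑' i, ∫ t, F i t ∂μ := by
  let G : Unit ⊕ ι → α → ℂ := Sum.elim (fun _ => P) F
  have hG : ∀ i, Integrable (G i) μ := by rintro (i | i); exacts [hP, hF i]
  have hGs : Summable fun i => ∫ t, ‖G i t‖ ∂μ :=
    Summable.sum _ (hasSum_fintype _).summable hs
  have h1 := (hasSum_integral_of_summable_integral_norm hG hGs).tsum_eq
  have hF' : Summable fun i => ∫ t, F i t ∂μ :=
    hs.of_norm_bounded fun i => norm_integral_le_integral_norm _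
  have h2 : ∑' i, ∫ t, G i t ∂μ = (∫ t, P t ∂μ) + ∑' i, ∫ t, F i t ∂μ := by
    rw [Summable.tsum_sum (f := fun i => ∫ t, G i t ∂μ) (hasSum_fintype _).summable hF']
    simp [G]
  rw [← h2, h1]
  refine integral_congr_ae ?_
  filter_upwards [hp] with t ht
  rw [Summable.tsum_sum (f := fun i => G i t) (hasSum_fintype _).summable ht]
  simp [G]

lemma injective_prod_succ : Function.Injective (fun x : ℕ × ℕ => (x.1, x.2 + 1)) := by
  rintro ⟨a, b⟩ ⟨c, d⟩ h
  simpa using h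

lemma tsum_prod_eq_tsum_zero_add {g : ℕ × ℕ → ℂ} (hg : Summable g) :
    ∑' x, g x = ∑' m, g (m, 0) + ∑' x : ℕ × ℕ, g (x.1, x.2 + 1) := by
  have h1 : Summable fun x : ℕ × ℕ => g (x.1, x.2 + 1) := hg.comp_injective injective_prod_succ
  have h0 : Summable fun m => g (m, 0) :=
    hg.comp_injective (i := fun m : ℕ => (m, 0)) fun a b h => by simpa using h
  rw [hg.tsum_prod, h1.tsum_prod, ← h0.tsum_add h1.prod]
  exact tsum_congr fun m => (hg.prod_factor m).tsum_eq_zero_add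

lemma summable_norm_add_pow_mul_geometric (k : ℕ) (w : ℂ) {ρ : ℝ} (h0 : 0 ≤ ρ) (h1 : ρ < 1) :
    Summable fun p : ℕ => ‖(p : ℂ) + w‖ ^ k * ρ ^ p := by
  have hρ : ‖ρ‖ < 1 := by rwa [Real.norm_of_nonneg h0]
  have hs : Summable fun p : ℕ => 2 ^ (k - 1) * ((p : ℝ) ^ k * ρ ^ p + ‖w‖ ^ k * ρ ^ p) :=
    ((summable_pow_mul_geometric_of_norm_lt_one k hρ).add
      ((summable_geometric_of_lt_one h0 h1).mul_left _)).mul_left _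
  refine hs.of_nonneg_of_le (fun p => by positivity) fun p => ?_
  have h2 : ‖(p : ℂ) + w‖ ≤ p + ‖w‖ := by simpa using norm_add_le (p : ℂ) w
  calc ‖(p : ℂ) + w‖ ^ k * ρ ^ p ≤ (2 ^ (k - 1) * ((p : ℝ) ^ k + ‖w‖ ^ k)) * ρ ^ p := by
        gcongr
        exact (pow_le_pow_left₀ (norm_nonneg _) h2 k).trans
          (add_pow_le (by positivity) (by positivity) k)
    _ = _ := by ring

/-- The exponential `e^{c(m+1)y}`. -/
noncomputable def expTerm (c : ℂ) (m : ℕ) (y : ℂ) : ℂ := Complex.exp (c * ((m : ℂ) + 1) * y)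

lemma norm_expTerm (c : ℂ) (m : ℕ) (y : ℝ) :
    ‖expTerm c m y‖ = Real.exp (c.re * ((m + 1) * y)) := by
  have : c * ((m : ℂ) + 1) * (y : ℂ) = c * (((m + 1) * y : ℝ) : ℂ) := by push_cast; ring
  rw [expTerm, Complex.norm_exp, this, Complex.re_mul_ofReal]

lemma summable_add_pow_mul_expTerm {c : ℂ} (hc : c.re < 0) {t : ℝ} (ht : 0 < t) (k : ℕ) (w : ℂ) :
    Summable fun x : ℕ × ℕ => ((x.2 : ℂ) + w) ^ k * expTerm c x.1 ((x.2 : ℂ) + t) := by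
  have h1 : Summable fun m : ℕ => Real.exp (c.re * t) ^ m :=
    summable_geometric_of_lt_one (Real.exp_pos _).le
      (Real.exp_lt_one_iff.2 (mul_neg_of_neg_of_pos hc ht))
  have h2 := summable_norm_add_pow_mul_geometric k w (Real.exp_pos c.re).le (Real.exp_lt_one_iff.2 hc)
  refine (h1.mul_of_nonneg h2 (fun m => by positivity) fun p => by positivity).of_norm_bounded ?_
  rintro ⟨m, p⟩
  have e : ((p : ℂ) + t) = ((p + t : ℝ) : ℂ) := by push_cast; rfl
  simp only
  rw [norm_mul, norm_pow, e, norm_expTerm, ← Real.exp_nat_mul, ← Real.exp_nat_mul,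
    mul_left_comm (Real.exp _), ← Real.exp_add]
  gcongr
  have : 0 ≤ (m : ℝ) * p + t := by positivity
  nlinarith

lemma two_pi_I_mul_re_neg {τ : ℂ} (hτ : 0 < τ.im) : (2 * π * Complex.I * τ).re < 0 := by
  simp
  positivity

lemma expTerm_add_eq (τ : ℂ) (t : ℝ) (m p : ℕ) :
    expTerm (2 * π * Complex.I * τ) m (((p + 1 : ℕ) : ℂ) + t) =
      Complex.exp (2 * π * Complex.I * ((m : ℂ) + 1) * (τ * t)) *
        Complex.exp (2 * π * Complex.I * τ) ^ ((m + 1) * (p + 1)) := by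
  rw [expTerm, ← Complex.exp_nat_mul, ← Complex.exp_add]
  push_cast
  ring_nf

lemma expTerm_sub_eq (τ : ℂ) (t : ℝ) (m p : ℕ) :
    expTerm (2 * π * Complex.I * τ) m ((p : ℂ) + (1 - t : ℝ)) =
      Complex.exp (-(2 * π * Complex.I * ((m : ℂ) + 1) * (τ * t))) *
        Complex.exp (2 * π * Complex.I * τ) ^ ((m + 1) * (p + 1)) := by
  rw [expTerm, ← Complex.exp_nat_mul, ← Complex.exp_add]
  push_cast
  ring_nf

lemma pi_mul_cot_eq_expTerm {τ : ℂ} (hτ : 0 < τ.im) {t : ℝ} (h0 : 0 < t) :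
    π * Complex.cot (π * (τ * t)) =
      2 * π * Complex.I * (-1 / 2 - ∑' m : ℕ, expTerm (2 * π * Complex.I * τ) m t) := by
  have him : 0 < (τ * t).im := by simpa using mul_pos hτ h0
  have hcot := pi_mul_cot_pi_q_exp ⟨τ * t, him⟩
  simp only at hcot
  have hgeo : Summable fun m : ℕ => Complex.exp (2 * π * Complex.I * (τ * t)) ^ m := by
    refine summable_geometric_of_norm_lt_one ?_
    rw [Complex.norm_exp]
    refine Real.exp_lt_one_iff.2 ?_
    rw [← mul_assoc, Complex.re_mul_ofReal]
    exact mul_neg_of_neg_of_pos (two_pi_I_mul_re_neg hτ) h0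
  have e3 : ∀ m : ℕ, Complex.exp (2 * π * Complex.I * (τ * t)) ^ (m + 1) =
      expTerm (2 * π * Complex.I * τ) m t := by
    intro m
    rw [expTerm, ← Complex.exp_nat_mul]
    push_cast
    ring_nf
  rw [hcot, hgeo.tsum_eq_zero_add, tsum_congr e3]
  ring

lemma tsum_pow_mul_expTerm_shift {c : ℂ} (hc : c.re < 0) {t : ℝ} (h0 : 0 < t) (h1 : t < 1) (k : ℕ) :
    ∑' x : ℕ × ℕ, ((x.2 : ℂ) ^ k * expTerm c x.1 ((x.2 : ℂ) + t) +
        (-1 : ℂ) ^ (k + 1) * ((x.2 : ℂ) + 1) ^ k * expTerm c x.1 ((x.2 : ℂ) + (1 - t : ℝ))) =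
      ∑' m : ℕ, (0 : ℂ) ^ k * expTerm c m t +
      ∑' x : ℕ × ℕ, (((x.2 + 1 : ℕ) : ℂ) ^ k * expTerm c x.1 (((x.2 + 1 : ℕ) : ℂ) + t) +
        (-1 : ℂ) ^ (k + 1) * ((x.2 : ℂ) + 1) ^ k *
          expTerm c x.1 ((x.2 : ℂ) + (1 - t : ℝ))) := by
  have hA : Summable fun x : ℕ × ℕ => (x.2 : ℂ) ^ k * expTerm c x.1 ((x.2 : ℂ) + t) := by
    simpa using summable_add_pow_mul_expTerm hc h0 k 0
  have hB : Summable fun x : ℕ × ℕ => (-1 : ℂ) ^ (k + 1) * ((x.2 : ℂ) + 1) ^ k *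
      expTerm c x.1 ((x.2 : ℂ) + (1 - t : ℝ)) := by
    simpa only [mul_assoc] using
      (summable_add_pow_mul_expTerm hc (sub_pos.2 h1) k 1).mul_left ((-1 : ℂ) ^ (k + 1))
  have hA1 : Summable fun x : ℕ × ℕ =>
      ((x.2 + 1 : ℕ) : ℂ) ^ k * expTerm c x.1 (((x.2 + 1 : ℕ) : ℂ) + t) :=
    by simpa only [Function.comp_def] using hA.comp_injective injective_prod_succ
  have hZ : ∑' x : ℕ × ℕ, (x.2 : ℂ) ^ k * expTerm c x.1 ((x.2 : ℂ) + t) =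
      ∑' m : ℕ, ((0 : ℕ) : ℂ) ^ k * expTerm c m (((0 : ℕ) : ℂ) + t) +
        ∑' x : ℕ × ℕ, ((x.2 + 1 : ℕ) : ℂ) ^ k * expTerm c x.1 (((x.2 + 1 : ℕ) : ℂ) + t) :=
    tsum_prod_eq_tsum_zero_add hA
  rw [hA.tsum_add hB, hA1.tsum_add hB, hZ, add_assoc]
  simp only [Nat.cast_zero, zero_add]

lemma tsum_pow_mul_expTerm_eq {τ : ℂ} (hτ : 0 < τ.im) {t : ℝ} (h0 : 0 < t) (h1 : t < 1) (k : ℕ) :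
    ∑' x : ℕ × ℕ,
        ((x.2 : ℂ) ^ k * expTerm (2 * π * Complex.I * τ) x.1 ((x.2 : ℂ) + t) +
          (-1 : ℂ) ^ (k + 1) * ((x.2 : ℂ) + 1) ^ k *
            expTerm (2 * π * Complex.I * τ) x.1 ((x.2 : ℂ) + (1 - t : ℝ))) =
      ∑' m : ℕ, (0 : ℂ) ^ k * expTerm (2 * π * Complex.I * τ) m t +
      ∑' x : ℕ × ℕ, (Complex.exp (2 * π * Complex.I * ((x.1 : ℂ) + 1) * (τ * t)) +
        (-1 : ℂ) ^ (k + 1) *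
          Complex.exp (-(2 * π * Complex.I * ((x.1 : ℂ) + 1) * (τ * t)))) * ((x.2 : ℂ) + 1) ^ k *
          Complex.exp (2 * π * Complex.I * τ) ^ ((x.1 + 1) * (x.2 + 1)) := by
  have hc := two_pi_I_mul_re_neg hτ
  have key : ∀ x : ℕ × ℕ, (Complex.exp (2 * π * Complex.I * ((x.1 : ℂ) + 1) * (τ * t)) +
        (-1 : ℂ) ^ (k + 1) *
          Complex.exp (-(2 * π * Complex.I * ((x.1 : ℂ) + 1) * (τ * t)))) * ((x.2 : ℂ) + 1) ^ k *
          Complex.exp (2 * π * Complex.I * τ) ^ ((x.1 + 1) * (x.2 + 1)) =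
      ((x.2 + 1 : ℕ) : ℂ) ^ k *
        expTerm (2 * π * Complex.I * τ) x.1 (((x.2 + 1 : ℕ) : ℂ) + t) +
      (-1 : ℂ) ^ (k + 1) * ((x.2 : ℂ) + 1) ^ k *
        expTerm (2 * π * Complex.I * τ) x.1 ((x.2 : ℂ) + (1 - t : ℝ)) := by
    rintro ⟨m, p⟩
    rw [expTerm_add_eq, expTerm_sub_eq]
    push_cast
    ring
  rw [tsum_congr key]
  exact tsum_pow_mul_expTerm_shift hc h0 h1 k

lemma fKr_succ_eq {τ : ℂ} (hτ : 0 < τ.im) {t : ℝ} (h0 : 0 < t) (h1 : t < 1) (k : ℕ) :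
    fKr (k + 1) (τ * t) τ = 2 * π * Complex.I / (k ! : ℂ) *
      ((bernoulli (k + 1) : ℂ) / ((k : ℂ) + 1) - ∑' x : ℕ × ℕ,
        ((x.2 : ℂ) ^ k * expTerm (2 * π * Complex.I * τ) x.1 ((x.2 : ℂ) + t) +
          (-1 : ℂ) ^ (k + 1) * ((x.2 : ℂ) + 1) ^ k *
            expTerm (2 * π * Complex.I * τ) x.1 ((x.2 : ℂ) + (1 - t : ℝ)))) := by
  rw [tsum_pow_mul_expTerm_eq hτ h0 h1]
  cases k with
  | zero =>
    rw [fKr, pi_mul_cot_eq_expTerm hτ h0]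
    simp only [zero_add, bernoulli_one, pow_zero, pow_one, one_mul, mul_one, neg_mul,
      ← sub_eq_add_neg, Nat.factorial_zero, Nat.cast_zero, Nat.cast_one, div_one]
    push_cast
    ring
  | succ k =>
    rw [fKr]
    simp only [ne_eq, Nat.add_eq_zero_iff, one_ne_zero, and_false, not_false_eq_true, zero_pow,
      zero_mul, tsum_zero, zero_add]
    push_cast
    rw [add_assoc (k : ℂ) 1 1, one_add_one_eq_two]

lemma omKr_succ_eq {τ : ℂ} (hτ : 0 < τ.im) {t : ℝ} (h0 : 0 < t) (h1 : t < 1) (N : ℕ) :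
    omKr (N + 1) (τ * t) τ = 2 * π * Complex.I *
      (∑ j ∈ Finset.range (N + 1 + 1),
          (bernoulli j : ℂ) / ((j ! : ℂ) * ((N + 1 - j)! : ℂ)) * (t : ℂ) ^ (N + 1 - j) +
        ∑' x : ℕ × ℕ, -(1 / (N ! : ℂ)) *
          (((x.2 : ℂ) + t) ^ N * expTerm (2 * π * Complex.I * τ) x.1 ((x.2 : ℂ) + t) +
            (-1 : ℂ) ^ (N + 1) * ((x.2 : ℂ) + (1 - t : ℝ)) ^ N *
              expTerm (2 * π * Complex.I * τ) x.1 ((x.2 : ℂ) + (1 - t : ℝ)))) := by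
  set c := 2 * π * Complex.I * τ with hcdef
  have hc : c.re < 0 := two_pi_I_mul_re_neg hτ
  have him : (τ * t).im / τ.im = t := by
    rw [Complex.im_mul_ofReal]
    field_simp
  let S : ℕ → ℕ × ℕ → ℂ := fun k x =>
    (x.2 : ℂ) ^ k * expTerm c x.1 ((x.2 : ℂ) + t) +
          (-1 : ℂ) ^ (k + 1) * ((x.2 : ℂ) + 1) ^ k * expTerm c x.1 ((x.2 : ℂ) + (1 - t : ℝ))
  have hS : ∀ k, Summable (S k) := by
    intro k
    refine Summable.add ?_ ?_
    · simpa using summable_add_pow_mul_expTerm hc h0 k 0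
    · simpa only [mul_assoc] using
        (summable_add_pow_mul_expTerm hc (sub_pos.2 h1) k 1).mul_left ((-1 : ℂ) ^ (k + 1))
  have hsum : ∀ x : ℕ × ℕ, -(1 / (N ! : ℂ)) *
          (((x.2 : ℂ) + t) ^ N * expTerm c x.1 ((x.2 : ℂ) + t) +
            (-1 : ℂ) ^ (N + 1) * ((x.2 : ℂ) + (1 - t : ℝ)) ^ N *
              expTerm c x.1 ((x.2 : ℂ) + (1 - t : ℝ))) =
      ∑ k ∈ Finset.range (N + 1), -((t : ℂ) ^ (N - k) / ((N - k)! * k ! : ℂ)) * S k x := by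
    rintro ⟨m, p⟩
    have e1 : (-1 : ℂ) ^ (N + 1) * ((p : ℂ) + (1 - t : ℝ)) ^ N =
        -((-((p : ℂ) + 1)) + t) ^ N := by
      rw [pow_succ, mul_right_comm, ← mul_pow]
      push_cast
      ring_nf
    simp only [S]
    rw [e1, add_pow, add_pow, Finset.sum_mul, neg_mul (∑ _ ∈ _, _), Finset.sum_mul, ← sub_eq_add_neg,
      ← Finset.sum_sub_distrib, Finset.mul_sum]
    refine Finset.sum_congr rfl fun k hk => ?_
    have hk' : k ≤ N := Nat.lt_succ_iff.1 (Finset.mem_range.1 hk)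
    rw [Nat.cast_choose ℂ hk', neg_pow ((p : ℂ) + 1)]
    have f1 : (N ! : ℂ) ≠ 0 := by exact_mod_cast N.factorial_ne_zero
    have f2 : (k ! : ℂ) ≠ 0 := by exact_mod_cast k.factorial_ne_zero
    have f3 : ((N - k)! : ℂ) ≠ 0 := by exact_mod_cast (N - k).factorial_ne_zero
    field_simp
    ring
  rw [tsum_congr hsum, Summable.tsum_finsetSum fun k _ => (hS k).mul_left _]
  simp only [tsum_mul_left]
  rw [omKr, ← Finset.sum_flip, Finset.sum_range_succ', Finset.sum_range_succ' _ (N + 1)]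
  rw [add_right_comm, ← Finset.sum_add_distrib, mul_add, Finset.mul_sum]
  congr 1
  · refine Finset.sum_congr rfl fun k hk => ?_
    have hk' : k ≤ N := Nat.lt_succ_iff.1 (Finset.mem_range.1 hk)
    have e : N + 1 - (N + 1 - (k + 1)) = k + 1 := by omega
    have e' : N + 1 - (k + 1) = N - k := by omega
    rw [e, e', fKr_succ_eq hτ h0 h1, him, Nat.factorial_succ]
    have f2 : (k ! : ℂ) ≠ 0 := by exact_mod_cast k.factorial_ne_zero
    have f3 : ((N - k)! : ℂ) ≠ 0 := by exact_mod_cast (N - k).factorial_ne_zero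
    have f4 : (k : ℂ) + 1 ≠ 0 := by exact_mod_cast k.succ_ne_zero
    simp only [← hcdef, S]
    push_cast
    field_simp
    ring
  · rw [Nat.sub_zero, Nat.sub_self, him]
    simp [fKr]
    ring

lemma continuous_expTerm (c : ℂ) (m : ℕ) : Continuous (expTerm c m) := by
  unfold expTerm
  fun_prop

/-- The summand indexed by `x = (m, p)` of the integrand `t ^ r * ω_{N+1}(τt, τ)`, up to a constant,
with `c = 2πiτ`. -/
noncomputable def momentTerm (c : ℂ) (N r : ℕ) (x : ℕ × ℕ) (t : ℝ) : ℂ :=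
  (t : ℂ) ^ r * (((x.2 : ℂ) + t) ^ N * expTerm c x.1 ((x.2 : ℂ) + t) +
    (-1 : ℂ) ^ (N + 1) * ((x.2 : ℂ) + (1 - t : ℝ)) ^ N * expTerm c x.1 ((x.2 : ℂ) + (1 - t : ℝ)))

lemma continuous_momentTerm (c : ℂ) (N r : ℕ) (x : ℕ × ℕ) : Continuous (momentTerm c N r x) := by
  unfold momentTerm
  have h1 : Continuous fun t : ℝ => expTerm c x.1 ((x.2 : ℂ) + t) :=
    (continuous_expTerm c x.1).comp (by fun_prop)
  have h2 : Continuous fun t : ℝ => expTerm c x.1 ((x.2 : ℂ) + (1 - t : ℝ)) :=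
    (continuous_expTerm c x.1).comp (by fun_prop)
  fun_prop

lemma integrableOn_momentTerm (c : ℂ) (N r : ℕ) (x : ℕ × ℕ) :
    IntegrableOn (momentTerm c N r x) (Set.Ioo 0 1) :=
  ((continuous_momentTerm c N r x).integrableOn_Icc).mono_set Set.Ioo_subset_Icc_self

lemma norm_momentTerm_le (c : ℂ) (N r : ℕ) (m p : ℕ) {t : ℝ} (h0 : 0 ≤ t) (h1 : t ≤ 1) :
    ‖momentTerm c N r (m, p) t‖ ≤
      t ^ r * ((p + t) ^ N * Real.exp (c.re * ((m + 1) * (p + t))) +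
        (p + (1 - t)) ^ N * Real.exp (c.re * ((m + 1) * (p + (1 - t))))) := by
  have e1 : (p : ℂ) + t = ((p + t : ℝ) : ℂ) := by push_cast; rfl
  have e2 : (p : ℂ) + (1 - t : ℝ) = ((p + (1 - t) : ℝ) : ℂ) := by push_cast; rfl
  have h3 : 0 ≤ (p : ℝ) + t := by positivity
  have h4 : 0 ≤ (p : ℝ) + (1 - t) := add_nonneg p.cast_nonneg (sub_nonneg.2 h1)
  simp only [momentTerm]
  rw [e1, e2, norm_mul, norm_pow, Complex.norm_real, Real.norm_of_nonneg h0]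
  gcongr
  refine (norm_add_le _ _).trans_eq ?_
  rw [norm_mul, norm_mul, norm_mul, norm_expTerm, norm_expTerm]
  simp only [norm_pow, norm_neg, norm_one, one_pow, one_mul, Complex.norm_real,
    Real.norm_of_nonneg h3, Real.norm_of_nonneg h4]

lemma norm_momentTerm_le_of_re_le {c : ℂ} (hc : c.re ≤ -2) {N r : ℕ} (hN : 1 ≤ N) (hr : 1 ≤ r)
    (m p : ℕ) {t : ℝ} (h0 : 0 ≤ t) (h1 : t ≤ 1) :
    ‖momentTerm c N r (m, p) t‖ ≤ ((p : ℝ) + 1) ^ N * Real.exp (-1) ^ p *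
      (t * Real.exp (-((m + 1) * t)) + (1 - t) * Real.exp (-((m + 1) * (1 - t))) +
        Real.exp (-(m + 1))) := by
  refine (norm_momentTerm_le c N r m p h0 h1).trans ?_
  have hs : 0 ≤ 1 - t := sub_nonneg.2 h1
  have hm : (0 : ℝ) ≤ m := m.cast_nonneg
  have hp : (0 : ℝ) ≤ p := p.cast_nonneg
  have hexp : ∀ y : ℝ, 0 ≤ y → c.re * ((m + 1) * y) ≤ -2 * ((m + 1) * y) := fun y hy =>
    mul_le_mul_of_nonneg_right hc (by positivity)
  have b1 : t ^ r * ((p + t) ^ N * Real.exp (c.re * ((m + 1) * (p + t)))) ≤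
      t * (((p : ℝ) + 1) ^ N * (Real.exp (-1) ^ p * Real.exp (-((m + 1) * t)))) := by
    gcongr
    · exact pow_le_of_le_one h0 h1 (by omega)
    · rw [← Real.exp_nat_mul, ← Real.exp_add, Real.exp_le_exp]
      refine (hexp _ (by positivity)).trans ?_
      have : 0 ≤ (m : ℝ) * p := by positivity
      have : 0 ≤ (m : ℝ) * t := by positivity
      nlinarith
  have b2 : t ^ r * ((p + (1 - t)) ^ N * Real.exp (c.re * ((m + 1) * (p + (1 - t))))) ≤
      ((p : ℝ) + 1) ^ N * Real.exp (-1) ^ p *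
        ((1 - t) * Real.exp (-((m + 1) * (1 - t))) + Real.exp (-(m + 1))) := by
    have b3 : t ^ r * ((p + (1 - t)) ^ N * Real.exp (c.re * ((m + 1) * (p + (1 - t))))) ≤
        (p + (1 - t)) ^ N * Real.exp (c.re * ((m + 1) * (p + (1 - t)))) :=
      mul_le_of_le_one_left (by positivity) (pow_le_one₀ h0 h1)
    refine b3.trans ?_
    rcases Nat.eq_zero_or_pos p with rfl | hp1
    · simp only [Nat.cast_zero, zero_add, one_pow, pow_zero, one_mul]
      have : (1 - t) ^ N * Real.exp (c.re * ((m + 1) * (1 - t))) ≤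
          (1 - t) * Real.exp (-((m + 1) * (1 - t))) := by
        gcongr
        · exact pow_le_of_le_one hs (by linarith) (by omega)
        · refine (hexp _ hs).trans ?_
          have : 0 ≤ ((m : ℝ) + 1) * (1 - t) := by positivity
          linarith
      have := Real.exp_pos (-((m : ℝ) + 1))
      linarith
    · have hp1' : (1 : ℝ) ≤ p := by exact_mod_cast hp1
      calc _ ≤ ((p : ℝ) + 1) ^ N * (Real.exp (-1) ^ p * Real.exp (-(m + 1))) := by
            gcongr
            · linarith
            · rw [← Real.exp_nat_mul, ← Real.exp_add, Real.exp_le_exp]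
              refine (hexp _ (by positivity)).trans ?_
              have : 0 ≤ (m : ℝ) * (p - 1) := mul_nonneg hm (by linarith)
              have : 0 ≤ (m : ℝ) * (1 - t) := by positivity
              nlinarith
        _ ≤ _ := by
            rw [mul_assoc]
            gcongr
            have : 0 ≤ (1 - t) * Real.exp (-((m + 1) * (1 - t))) := by positivity
            linarith
  rw [mul_add]
  refine (add_le_add b1 b2).trans_eq ?_
  ring

lemma setIntegral_Ioo_eq_intervalIntegral {E : Type*} [NormedAddCommGroup E] [NormedSpace ℝ E]
    (f : ℝ → E) : ∫ t in Set.Ioo (0 : ℝ) 1, f t = ∫ t in (0 : ℝ)..1, f t := by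
  rw [intervalIntegral.integral_of_le zero_le_one, integral_Ioc_eq_integral_Ioo]

lemma summable_cast_add_one_pow_mul_exp (N : ℕ) :
    Summable fun p : ℕ => ((p : ℝ) + 1) ^ N * Real.exp (-1) ^ p := by
  have h := summable_norm_add_pow_mul_geometric N 1 (Real.exp_pos (-1)).le
    (Real.exp_lt_one_iff.2 (by norm_num))
  refine h.congr fun p => ?_
  have : ‖(p : ℂ) + 1‖ = (p : ℝ) + 1 := by exact_mod_cast Complex.norm_natCast (p + 1)
  rw [this]

lemma summable_integral_norm_momentTerm {c : ℂ} (hc : c.re ≤ -2) {N r : ℕ} (hN : 1 ≤ N)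
    (hr : 1 ≤ r) : Summable fun x => ∫ t in Set.Ioo (0 : ℝ) 1, ‖momentTerm c N r x t‖ := by
  obtain ⟨K, hK, h⟩ := exists_integral_pow_mul_exp_neg_le le_rfl
  have hsq : Summable fun m : ℕ => (2 * K + 2) / ((m : ℝ) + 1) ^ 2 := by
    have := (summable_nat_add_iff 1).2 (Real.summable_one_div_nat_pow.2 one_lt_two)
    refine (this.mul_left (2 * K + 2)).congr fun m => ?_
    push_cast
    ring
  refine (hsq.mul_of_nonneg (summable_cast_add_one_pow_mul_exp N) (fun m => by positivity)
    fun p => by positivity).of_nonneg_of_le (fun x => integral_nonneg fun t => norm_nonneg _) ?_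
  rintro ⟨m, p⟩
  rw [setIntegral_Ioo_eq_intervalIntegral]
  have hm1 : (1 : ℝ) ≤ (m : ℝ) + 1 := by have : (0 : ℝ) ≤ m := m.cast_nonneg
                                         linarith
  have i1 := h _ hm1
  simp only [pow_one] at i1
  have i2 : ∫ t in (0 : ℝ)..1, (1 - t) * Real.exp (-(((m : ℝ) + 1) * (1 - t))) =
      ∫ t in (0 : ℝ)..1, t * Real.exp (-(((m : ℝ) + 1) * t)) := by
    have := intervalIntegral.integral_comp_sub_left (a := 0) (b := 1)
      (fun t : ℝ => t * Real.exp (-(((m : ℝ) + 1) * t))) 1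
    simpa using this
  have i3 : Real.exp (-((m : ℝ) + 1)) ≤ 2 / ((m : ℝ) + 1) ^ 2 := by
    have := Real.pow_div_factorial_le_exp ((m : ℝ) + 1) (by positivity) 2
    rw [Real.exp_neg, inv_eq_one_div, div_le_div_iff₀ (Real.exp_pos _) (by positivity)]
    simp [Nat.factorial] at this
    linarith
  calc ∫ t in (0 : ℝ)..1, ‖momentTerm c N r (m, p) t‖
      ≤ ∫ t in (0 : ℝ)..1, ((p : ℝ) + 1) ^ N * Real.exp (-1) ^ p *
      (t * Real.exp (-(((m : ℝ) + 1) * t)) + (1 - t) * Real.exp (-(((m : ℝ) + 1) * (1 - t))) +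
        Real.exp (-((m : ℝ) + 1))) := by
        refine intervalIntegral.integral_mono_on zero_le_one
          ((continuous_momentTerm c N r _).norm.intervalIntegrable _ _)
          (by apply Continuous.intervalIntegrable; fun_prop) fun t ht => ?_
        exact norm_momentTerm_le_of_re_le hc hN hr m p ht.1 ht.2
    _ = ((p : ℝ) + 1) ^ N * Real.exp (-1) ^ p *
        (2 * (∫ t in (0 : ℝ)..1, t * Real.exp (-(((m : ℝ) + 1) * t))) +
          Real.exp (-((m : ℝ) + 1))) := by
        rw [intervalIntegral.integral_const_mul,
          intervalIntegral.integral_add (by apply Continuous.intervalIntegrable; fun_prop)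
            (by apply Continuous.intervalIntegrable; fun_prop),
          intervalIntegral.integral_add (by apply Continuous.intervalIntegrable; fun_prop)
            (by apply Continuous.intervalIntegrable; fun_prop), i2, intervalIntegral.integral_const,
          sub_zero, one_smul]
        ring
    _ ≤ ((p : ℝ) + 1) ^ N * Real.exp (-1) ^ p *
        (2 * (K / ((m : ℝ) + 1) ^ 2) + 2 / ((m : ℝ) + 1) ^ 2) := by
        gcongr
    _ = _ := by ring

lemma BellDepthOne_succ_eq {τ : ℂ} (hτ : 1 ≤ τ.im) {N r : ℕ} (hN : 1 ≤ N) (hr : 1 ≤ r) :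
    BellDepthOne (N + 1) r τ = (2 * π * Complex.I) ^ (r + 1) * τ ^ (N + 1) / (r ! : ℂ) *
      (∑ k ∈ Finset.range (N + 1 + 1),
        (bernoulli k : ℂ) / ((k ! : ℂ) * ((N + 1 - k)! : ℂ) * ((N + 1 - k + r + 1 : ℕ) : ℂ)) -
      1 / (N ! : ℂ) * ∑' x, ∫ t in Set.Ioo (0 : ℝ) 1,
        momentTerm (2 * π * Complex.I * τ) N r x t) := by
  have hτ0 : 0 < τ.im := by linarith
  have hc : (2 * π * Complex.I * τ).re ≤ -2 := by
    simp
    nlinarith [Real.pi_gt_three]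
  let P : ℝ → ℂ := fun t => ∑ j ∈ Finset.range (N + 1 + 1),
    (bernoulli j : ℂ) / ((j ! : ℂ) * ((N + 1 - j)! : ℂ)) * (t : ℂ) ^ (N + 1 - j + r)
  have hPc : Continuous P := by fun_prop
  have hP : ∫ t in Set.Ioo (0 : ℝ) 1, P t = ∑ k ∈ Finset.range (N + 1 + 1),
      (bernoulli k : ℂ) / ((k ! : ℂ) * ((N + 1 - k)! : ℂ) * ((N + 1 - k + r + 1 : ℕ) : ℂ)) := by
    rw [setIntegral_Ioo_eq_intervalIntegral, intervalIntegral.integral_finsetSum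
      fun i _ => by apply Continuous.intervalIntegrable; fun_prop]
    refine Finset.sum_congr rfl fun k _ => ?_
    have : ∫ t in (0 : ℝ)..1, (t : ℂ) ^ (N + 1 - k + r) = 1 / ((N + 1 - k + r + 1 : ℕ) : ℂ) := by
      have h := integral_pow (a := 0) (b := 1) (N + 1 - k + r)
      have h' := congrArg (fun x : ℝ => (x : ℂ)) h
      simp only [← intervalIntegral.integral_ofReal] at h'
      push_cast at h' ⊢
      simpa using h'
    rw [intervalIntegral.integral_const_mul, this, mul_one_div, div_div]
  have hmt : ∀ t ∈ Set.Ioo (0 : ℝ) 1,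
      Summable fun x => momentTerm (2 * π * Complex.I * τ) N r x t := by
    intro t ht
    have hA := summable_add_pow_mul_expTerm (two_pi_I_mul_re_neg hτ0) ht.1 N t
    have hB := summable_add_pow_mul_expTerm (two_pi_I_mul_re_neg hτ0) (sub_pos.2 ht.2) N
      (1 - t : ℝ)
    refine ((hA.add (hB.mul_left ((-1 : ℂ) ^ (N + 1)))).mul_left ((t : ℂ) ^ r)).congr fun x => ?_
    rw [momentTerm, mul_assoc ((-1 : ℂ) ^ (N + 1))]
  have hint : ∫ t in Set.Ioo (0 : ℝ) 1, (t : ℂ) ^ r * omKr (N + 1) (τ * t) τ =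
      2 * π * Complex.I * ∫ t in Set.Ioo (0 : ℝ) 1,
        (P t + ∑' x, -(1 / (N ! : ℂ)) * momentTerm (2 * π * Complex.I * τ) N r x t) := by
    rw [← integral_const_mul]
    refine setIntegral_congr_fun measurableSet_Ioo fun t ht => ?_
    rw [omKr_succ_eq hτ0 ht.1 ht.2, mul_left_comm, mul_add, ← tsum_mul_left, Finset.mul_sum]
    congr 2
    · refine Finset.sum_congr rfl fun k _ => ?_
      rw [pow_add]
      ring
    · refine tsum_congr fun x => ?_
      rw [momentTerm, mul_left_comm]
  have hF : Summable fun x => ∫ t in Set.Ioo (0 : ℝ) 1,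
      ‖-(1 / (N ! : ℂ)) * momentTerm (2 * π * Complex.I * τ) N r x t‖ := by
    simp only [norm_mul, integral_const_mul]
    exact (summable_integral_norm_momentTerm hc hN hr).mul_left _
  rw [BellDepthOne, hint, integral_add_tsum
    (hPc.integrableOn_Icc.mono_set Set.Ioo_subset_Icc_self)
    (fun x => (integrableOn_momentTerm _ N r x).const_mul _) hF, hP]
  · simp only [integral_const_mul, tsum_mul_left]
    ring
  · exact (ae_restrict_mem measurableSet_Ioo).mono fun t ht => (hmt t ht).mul_left _

lemma hasSum_one_div_neg_mul_pow (c : ℂ) {a : ℕ} (ha : 1 ≤ a) (b : ℂ) :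
    HasSum (fun m : ℕ => b / (-(c * ((m : ℂ) + 1))) ^ (a + 1))
      (b * riemannZeta ((a + 1 : ℕ) : ℂ) / (-c) ^ (a + 1)) := by
  have hs : Summable fun n : ℕ => 1 / (n : ℂ) ^ (a + 1) := by
    rw [← summable_norm_iff]
    simpa using Real.summable_one_div_nat_pow.2 (show 1 < a + 1 by omega)
  have hz : HasSum (fun m : ℕ => 1 / ((m + 1 : ℕ) : ℂ) ^ (a + 1))
      (riemannZeta ((a + 1 : ℕ) : ℂ)) := by
    rw [hasSum_nat_add_iff (f := fun n : ℕ => 1 / (n : ℂ) ^ (a + 1)) 1,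
      zeta_nat_eq_tsum_of_gt_one (by omega)]
    simpa using hs.hasSum
  convert! hz.mul_left (b / (-c) ^ (a + 1)) using 1
  · ext m
    rw [← neg_mul, mul_pow]
    push_cast
    rw [div_mul_div_comm, mul_one]
  · ring

/-- Summing the moments of the exponentials `e^{c(m+1)s}` produces a zeta value, up to an
exponentially small error. -/
lemma exists_norm_tsum_integral_pow_mul_expTerm_sub_le {a : ℕ} (ha : 1 ≤ a) :
    ∃ K : ℝ, 0 ≤ K ∧ ∀ c : ℂ, c.re ≤ -2 →
      Summable (fun m => ∫ s in (0 : ℝ)..1, (s : ℂ) ^ a * expTerm c m s) ∧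
      ‖∑' m, (∫ s in (0 : ℝ)..1, (s : ℂ) ^ a * expTerm c m s) -
        (a ! : ℂ) * riemannZeta ((a + 1 : ℕ) : ℂ) / (-c) ^ (a + 1)‖ ≤ K * Real.exp c.re := by
  obtain ⟨K, hK, h⟩ := exists_norm_integral_pow_mul_exp_sub_le a
  have hgeo : Summable fun m : ℕ => Real.exp (-1) ^ m :=
    summable_geometric_of_lt_one (Real.exp_pos _).le (Real.exp_lt_one_iff.2 (by norm_num))
  refine ⟨K * ∑' m : ℕ, Real.exp (-1) ^ m, by positivity, fun c hc => ?_⟩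
  have hz := hasSum_one_div_neg_mul_pow c ha (a ! : ℂ)
  have hb : ∀ m : ℕ, ‖(∫ s in (0 : ℝ)..1, (s : ℂ) ^ a * expTerm c m s) -
      (a ! : ℂ) / (-(c * ((m : ℂ) + 1))) ^ (a + 1)‖ ≤
        K * Real.exp c.re * Real.exp (-1) ^ m := by
    intro m
    have hm : (0 : ℝ) ≤ m := m.cast_nonneg
    have e : ‖(m : ℂ) + 1‖ = (m : ℝ) + 1 := by exact_mod_cast Complex.norm_natCast (m + 1)
    have hre : (c * ((m : ℂ) + 1)).re = c.re * (m + 1) := by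
      have : (m : ℂ) + 1 = ((m + 1 : ℝ) : ℂ) := by push_cast; rfl
      rw [this, Complex.re_mul_ofReal]
    have hn : 1 ≤ ‖c * ((m : ℂ) + 1)‖ := by
      rw [norm_mul, e]
      have := (neg_le_abs c.re).trans (Complex.abs_re_le_norm c)
      nlinarith
    refine (h _ hn).trans ?_
    rw [hre, mul_assoc, ← Real.exp_nat_mul, ← Real.exp_add]
    gcongr
    nlinarith
  have hd : Summable fun m : ℕ => (∫ s in (0 : ℝ)..1, (s : ℂ) ^ a * expTerm c m s) -
      (a ! : ℂ) / (-(c * ((m : ℂ) + 1))) ^ (a + 1) :=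
    (hgeo.mul_left _).of_norm_bounded hb
  have hJ : Summable fun m => ∫ s in (0 : ℝ)..1, (s : ℂ) ^ a * expTerm c m s := by
    simpa using hd.add hz.summable
  refine ⟨hJ, ?_⟩
  rw [← hz.tsum_eq, ← hJ.tsum_sub hz.summable]
  refine (tsum_of_norm_bounded (hgeo.mul_left _).hasSum hb).trans_eq ?_
  rw [tsum_mul_left]
  ring

lemma integral_momentTerm_zero (c : ℂ) (N r m : ℕ) :
    ∫ t in Set.Ioo (0 : ℝ) 1, momentTerm c N r (m, 0) t =
      (∫ s in (0 : ℝ)..1, (s : ℂ) ^ (N + r) * expTerm c m s) +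
        ∑ p ∈ Finset.range (r + 1), (-1 : ℂ) ^ (N + 1 + p) * (r.choose p : ℂ) *
          ∫ s in (0 : ℝ)..1, (s : ℂ) ^ (N + p) * expTerm c m s := by
  have hE : Continuous fun s : ℝ => expTerm c m s :=
    (continuous_expTerm c m).comp Complex.continuous_ofReal
  have hE' : Continuous fun s : ℝ => expTerm c m ((1 - s : ℝ) : ℂ) :=
    (continuous_expTerm c m).comp (by fun_prop)
  have h1 : ∀ t : ℝ, momentTerm c N r (m, 0) t = (t : ℂ) ^ (N + r) * expTerm c m t +
      (-1 : ℂ) ^ (N + 1) * (t : ℂ) ^ r * ((1 - t : ℝ) : ℂ) ^ N * expTerm c m ((1 - t : ℝ) : ℂ) := by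
    intro t
    simp only [momentTerm, Nat.cast_zero, zero_add]
    ring
  have h2 : ∫ t in (0 : ℝ)..1,
      (-1 : ℂ) ^ (N + 1) * (t : ℂ) ^ r * ((1 - t : ℝ) : ℂ) ^ N * expTerm c m ((1 - t : ℝ) : ℂ) =
      ∫ s in (0 : ℝ)..1, (-1 : ℂ) ^ (N + 1) * (1 - s : ℂ) ^ r * (s : ℂ) ^ N * expTerm c m s := by
    have := intervalIntegral.integral_comp_sub_left (a := 0) (b := 1)
      (fun s : ℝ => (-1 : ℂ) ^ (N + 1) * (1 - s : ℂ) ^ r * (s : ℂ) ^ N * expTerm c m s) 1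
    simpa using this
  have h3 : ∀ s : ℝ, (-1 : ℂ) ^ (N + 1) * (1 - s : ℂ) ^ r * (s : ℂ) ^ N * expTerm c m s =
      ∑ p ∈ Finset.range (r + 1), (-1 : ℂ) ^ (N + 1 + p) * (r.choose p : ℂ) *
        ((s : ℂ) ^ (N + p) * expTerm c m s) := by
    intro s
    rw [sub_eq_neg_add, add_pow, Finset.mul_sum, Finset.sum_mul, Finset.sum_mul]
    refine Finset.sum_congr rfl fun p _ => ?_
    rw [neg_pow (s : ℂ)]
    ring
  rw [setIntegral_Ioo_eq_intervalIntegral]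
  simp only [h1]
  rw [intervalIntegral.integral_add (by apply Continuous.intervalIntegrable; fun_prop)
    (by apply Continuous.intervalIntegrable; fun_prop), h2]
  simp only [h3]
  rw [intervalIntegral.integral_finsetSum
    fun i _ => by apply Continuous.intervalIntegrable; fun_prop]
  simp only [intervalIntegral.integral_const_mul]

/-- The main term of the sum of the integrals of `momentTerm`. -/
noncomputable def momentMain (c : ℂ) (N r : ℕ) : ℂ :=
  ((N + r)! : ℂ) * riemannZeta ((N + r + 1 : ℕ) : ℂ) / (-c) ^ (N + r + 1) +
    ∑ p ∈ Finset.range (r + 1), (-1 : ℂ) ^ (N + 1 + p) * (r.choose p : ℂ) *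
      (((N + p)! : ℂ) * riemannZeta ((N + p + 1 : ℕ) : ℂ) / (-c) ^ (N + p + 1))

lemma exists_norm_tsum_integral_momentTerm_zero_sub_le {N : ℕ} (hN : 1 ≤ N) (r : ℕ) :
    ∃ K : ℝ, 0 ≤ K ∧ ∀ c : ℂ, c.re ≤ -2 →
      ‖∑' m, (∫ t in Set.Ioo (0 : ℝ) 1, momentTerm c N r (m, 0) t) - momentMain c N r‖ ≤
        K * Real.exp c.re := by
  choose K hK h using fun p : ℕ =>
    exists_norm_tsum_integral_pow_mul_expTerm_sub_le (a := N + p) (by omega)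
  refine ⟨K r + ∑ p ∈ Finset.range (r + 1), (r.choose p : ℝ) * K p,
    add_nonneg (hK r) (Finset.sum_nonneg fun p _ => mul_nonneg (Nat.cast_nonneg _) (hK p)),
    fun c hc => ?_⟩
  have hs : ∀ p, Summable (fun m => ∫ s in (0 : ℝ)..1, (s : ℂ) ^ (N + p) * expTerm c m s) :=
    fun p => (h p c hc).1
  simp only [integral_momentTerm_zero]
  rw [(hs r).tsum_add (summable_sum fun p _ => (hs p).mul_left _),
    Summable.tsum_finsetSum fun p _ => (hs p).mul_left _]
  simp only [tsum_mul_left]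
  rw [momentMain, add_sub_add_comm, ← Finset.sum_sub_distrib, add_mul, Finset.sum_mul]
  refine (norm_add_le _ _).trans (add_le_add ((h r c hc).2) ((norm_sum_le _ _).trans
    (Finset.sum_le_sum fun p _ => ?_)))
  rw [← mul_sub, norm_mul, norm_mul, norm_pow, norm_neg, norm_one, one_pow, one_mul,
    Complex.norm_natCast, mul_assoc]
  exact mul_le_mul_of_nonneg_left (h p c hc).2 (Nat.cast_nonneg _)

lemma exists_norm_tsum_integral_momentTerm_succ_le (N r : ℕ) :
    ∃ K : ℝ, 0 ≤ K ∧ ∀ c : ℂ, c.re ≤ -2 →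
      ‖∑' x : ℕ × ℕ, ∫ t in Set.Ioo (0 : ℝ) 1, momentTerm c N r (x.1, x.2 + 1) t‖ ≤
        K * Real.exp c.re := by
  have hgeo : Summable fun m : ℕ => Real.exp (-1) ^ m :=
    summable_geometric_of_lt_one (Real.exp_pos _).le (Real.exp_lt_one_iff.2 (by norm_num))
  have hpow : Summable fun p : ℕ => ((p : ℝ) + 2) ^ N * Real.exp (-1) ^ p := by
    refine (summable_norm_add_pow_mul_geometric N 2 (Real.exp_pos (-1)).le
      (Real.exp_lt_one_iff.2 (by norm_num))).congr fun p => ?_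
    have : ‖(p : ℂ) + 2‖ = (p : ℝ) + 2 := by exact_mod_cast Complex.norm_natCast (p + 2)
    rw [this]
  have hs : Summable fun x : ℕ × ℕ =>
      Real.exp (-1) ^ x.1 * (((x.2 : ℝ) + 2) ^ N * Real.exp (-1) ^ x.2) :=
    hgeo.mul_of_nonneg hpow (fun m => by positivity) fun p => by positivity
  refine ⟨2 * ∑' x : ℕ × ℕ, Real.exp (-1) ^ x.1 * (((x.2 : ℝ) + 2) ^ N * Real.exp (-1) ^ x.2),
    mul_nonneg zero_le_two (tsum_nonneg fun x => by positivity), fun c hc => ?_⟩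
  have hb : ∀ x : ℕ × ℕ, ‖∫ t in Set.Ioo (0 : ℝ) 1, momentTerm c N r (x.1, x.2 + 1) t‖ ≤
      2 * Real.exp c.re * (Real.exp (-1) ^ x.1 * (((x.2 : ℝ) + 2) ^ N * Real.exp (-1) ^ x.2)) := by
    rintro ⟨m, p⟩
    have hm : (0 : ℝ) ≤ m := m.cast_nonneg
    have hp : (0 : ℝ) ≤ p := p.cast_nonneg
    have hexp : ∀ s : ℝ, 0 ≤ s → Real.exp (c.re * ((m + 1) * (((p + 1 : ℕ) : ℝ) + s))) ≤
        Real.exp c.re * (Real.exp (-1) ^ m * Real.exp (-1) ^ p) := by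
      intro s hs
      rw [← Real.exp_nat_mul, ← Real.exp_nat_mul, ← Real.exp_add, ← Real.exp_add, Real.exp_le_exp]
      push_cast
      have h1 : 0 ≤ (m : ℝ) * p + m * s + s := by positivity
      have h2 : c.re * ((m : ℝ) * p + m * s + s + (m + p)) ≤
          -1 * ((m : ℝ) * p + m * s + s + (m + p)) :=
        mul_le_mul_of_nonneg_right (by linarith) (by positivity)
      nlinarith
    have hle : ∀ t ∈ Set.Ioo (0 : ℝ) 1, ‖momentTerm c N r (m, p + 1) t‖ ≤
        2 * Real.exp c.re * (Real.exp (-1) ^ m * (((p : ℝ) + 2) ^ N * Real.exp (-1) ^ p)) := by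
      intro t ht
      have ht0 : 0 ≤ t := ht.1.le
      have ht1 : 0 ≤ 1 - t := sub_nonneg.2 ht.2.le
      refine (norm_momentTerm_le c N r m (p + 1) ht0 ht.2.le).trans ?_
      refine (mul_le_of_le_one_left (by positivity) (pow_le_one₀ ht0 ht.2.le)).trans ?_
      have hpow : ∀ s : ℝ, 0 ≤ s → s ≤ 1 → (((p + 1 : ℕ) : ℝ) + s) ^ N *
          Real.exp (c.re * ((m + 1) * (((p + 1 : ℕ) : ℝ) + s))) ≤
          ((p : ℝ) + 2) ^ N * (Real.exp c.re * (Real.exp (-1) ^ m * Real.exp (-1) ^ p)) := by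
        intro s hs hs1
        refine mul_le_mul (pow_le_pow_left₀ (by positivity) ?_ N) (hexp s hs) (by positivity)
          (by positivity)
        push_cast
        linarith
      refine (add_le_add (hpow t ht0 ht.2.le) (hpow (1 - t) ht1 (by linarith))).trans_eq ?_
      ring
    refine (norm_setIntegral_le_of_norm_le_const (by simp) hle).trans_eq ?_
    simp
  refine (tsum_of_norm_bounded (hs.mul_left _).hasSum hb).trans_eq ?_
  rw [tsum_mul_left]
  ring

lemma exists_norm_tsum_integral_momentTerm_sub_le {N r : ℕ} (hN : 1 ≤ N) (hr : 1 ≤ r) :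
    ∃ K : ℝ, 0 ≤ K ∧ ∀ c : ℂ, c.re ≤ -2 →
      ‖∑' x, (∫ t in Set.Ioo (0 : ℝ) 1, momentTerm c N r x t) - momentMain c N r‖ ≤
        K * Real.exp c.re := by
  obtain ⟨K, hK, h⟩ := exists_norm_tsum_integral_momentTerm_zero_sub_le hN r
  obtain ⟨L, hL, h'⟩ := exists_norm_tsum_integral_momentTerm_succ_le N r
  refine ⟨K + L, by positivity, fun c hc => ?_⟩
  have hs : Summable fun x => ∫ t in Set.Ioo (0 : ℝ) 1, momentTerm c N r x t :=
    (summable_integral_norm_momentTerm hc hN hr).of_norm_bounded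
      fun x => norm_integral_le_integral_norm _
  rw [tsum_prod_eq_tsum_zero_add hs, add_sub_right_comm, add_mul]
  exact (norm_add_le _ _).trans (add_le_add (h c hc) (h' c hc))

lemma laurentP_succ_eq {τ : ℂ} (hτ : τ ≠ 0) (N r : ℕ) :
    laurentP (N + 1) r τ = (2 * π * Complex.I) ^ (r + 1) * τ ^ (N + 1) / (r ! : ℂ) *
      (∑ k ∈ Finset.range (N + 1 + 1),
        (bernoulli k : ℂ) / ((k ! : ℂ) * ((N + 1 - k)! : ℂ) * ((N + 1 - k + r + 1 : ℕ) : ℂ)) -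
      1 / (N ! : ℂ) * momentMain (2 * π * Complex.I * τ) N r) := by
  have hu : (2 * π * Complex.I : ℂ) ≠ 0 := Complex.two_pi_I_ne_zero
  have hterm : ∀ p, p ≤ r → (1 / ((r - p)! : ℂ)) * ((N + 1 + p - 1).choose p : ℂ) *
      (2 * π * Complex.I) ^ ((r : ℤ) + 1 - ((N + 1 : ℕ) : ℤ) - (p : ℤ)) *
      riemannZeta ((N + 1 + p : ℕ) : ℂ) * τ ^ (-(p : ℤ)) =
      (2 * π * Complex.I) ^ (r + 1) * τ ^ (N + 1) / (r ! : ℂ) * (1 / (N ! : ℂ) *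
        ((-1 : ℂ) ^ (N + 1 + p) * (r.choose p : ℂ) *
          (((N + p)! : ℂ) * riemannZeta ((N + p + 1 : ℕ) : ℂ) /
            (-(2 * π * Complex.I * τ)) ^ (N + p + 1)))) := by
    intro p hp
    have e1 : N + 1 + p - 1 = N + p := by omega
    have e2 : N + 1 + p = N + p + 1 := by omega
    have e3 : (r : ℤ) + 1 - ((N + 1 : ℕ) : ℤ) - (p : ℤ) =
      ((r + 1 : ℕ) : ℤ) - ((N + p + 1 : ℕ) : ℤ) := by push_cast; ring
    have f1 : (N ! : ℂ) ≠ 0 := by exact_mod_cast N.factorial_ne_zero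
    have f2 : (r ! : ℂ) ≠ 0 := by exact_mod_cast r.factorial_ne_zero
    have f3 : ((r - p)! : ℂ) ≠ 0 := by exact_mod_cast (r - p).factorial_ne_zero
    have f4 : (p ! : ℂ) ≠ 0 := by exact_mod_cast p.factorial_ne_zero
    have hsg : ((-1 : ℂ) ^ (N + p + 1)) ≠ 0 := pow_ne_zero _ (by norm_num)
    rw [e1, e2, e3, zpow_sub₀ hu, zpow_natCast, zpow_natCast, zpow_neg, zpow_natCast,
      Nat.cast_choose ℂ hp, Nat.cast_choose ℂ (Nat.le_add_left p N), Nat.add_sub_cancel,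
      neg_pow (2 * π * Complex.I * τ), mul_pow (2 * π * Complex.I : ℂ) τ]
    generalize (2 * π * Complex.I : ℂ) = u at hu ⊢
    generalize riemannZeta _ = z
    rw [show N + p + 1 = (N + 1) + p by ring, pow_add τ]
    rw [show N + p + 1 = (N + 1) + p by ring] at hsg
    field_simp
    ring
  have hlast : (-1 : ℂ) ^ (N + 1 + r) * ((N + 1 + r - 1).choose r : ℂ) *
      (2 * π * Complex.I) ^ (1 - ((N + 1 : ℕ) : ℤ)) * riemannZeta ((N + 1 + r : ℕ) : ℂ) *
        τ ^ (-(r : ℤ)) =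
      (2 * π * Complex.I) ^ (r + 1) * τ ^ (N + 1) / (r ! : ℂ) * (1 / (N ! : ℂ) *
        (((N + r)! : ℂ) * riemannZeta ((N + r + 1 : ℕ) : ℂ) /
          (-(2 * π * Complex.I * τ)) ^ (N + r + 1))) := by
    have h := hterm r le_rfl
    have e3 : (r : ℤ) + 1 - ((N + 1 : ℕ) : ℤ) - (r : ℤ) = 1 - ((N + 1 : ℕ) : ℤ) := by ring
    have hsq : (-1 : ℂ) ^ (N + 1 + r) * (-1 : ℂ) ^ (N + 1 + r) = 1 := by
      rw [← mul_pow]; simp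
    rw [e3, Nat.sub_self, Nat.factorial_zero, Nat.choose_self] at h
    push_cast at h ⊢
    linear_combination (-1 : ℂ) ^ (N + 1 + r) * h +
      (2 * π * Complex.I) ^ (r + 1) * τ ^ (N + 1) / (r ! : ℂ) * (1 / (N ! : ℂ) *
        (((N + r)! : ℂ) * riemannZeta ((N : ℂ) + r + 1) /
          (-(2 * π * Complex.I * τ)) ^ (N + r + 1))) * hsq
  have hr := hterm r le_rfl
  have e3 : (r : ℤ) + 1 - ((N + 1 : ℕ) : ℤ) - (r : ℤ) = 1 - ((N + 1 : ℕ) : ℤ) := by ring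
  rw [e3, Nat.sub_self, Nat.factorial_zero, Nat.cast_one, div_one, one_mul] at hr
  rw [laurentP, Finset.sum_congr rfl fun p hp => hterm p (Finset.mem_range.1 hp).le, add_mul,
    add_mul, add_mul, add_mul, one_mul, hr, hlast, ← Finset.mul_sum, ← Finset.mul_sum,
    momentMain, Finset.sum_range_succ _ r]
  ring

/-- Asymptotic expansion of depth-one B-elliptic multiple zeta values:
`B(n,0,…,0;τ) = P(τ) + O(e^{−π Im τ})` as `Im τ → ∞` with `|Re τ| ≤ 1`. -/
theorem BellDepthOne_asymptotic (n r : ℕ) (hn : 2 ≤ n) (hr : 1 ≤ r) :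
    ∃ C T : ℝ, 0 < C ∧ 0 < T ∧
      ∀ τ : ℂ, 0 < τ.im → T ≤ τ.im → |τ.re| ≤ 1 →
        ‖BellDepthOne n r τ - laurentP n r τ‖ ≤ C * Real.exp (-(π * τ.im)) := by
  obtain ⟨N, rfl⟩ : ∃ N, n = N + 1 := ⟨n - 1, by omega⟩
  have hN : 1 ≤ N := by omega
  obtain ⟨K, hK, h⟩ := exists_norm_tsum_integral_momentTerm_sub_le hN hr
  have hA : 0 ≤ (2 * π) ^ (r + 1) / (r ! : ℝ) * (1 / (N ! : ℝ) * K) := by positivity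
  refine ⟨(2 * π) ^ (r + 1) / (r ! : ℝ) * (1 / (N ! : ℝ) * K) * (2 ^ (N + 1) * (N + 1)!) + 1, 1,
    by positivity, one_pos, fun τ hτ0 hτ hre => ?_⟩
  have hc : (2 * π * Complex.I * τ).re = -(2 * π * τ.im) := by simp
  have hc2 : (2 * π * Complex.I * τ).re ≤ -2 := by
    rw [hc]
    nlinarith [Real.pi_gt_three]
  have hne : τ ≠ 0 := by rintro rfl; simp at hτ0
  have hnorm : ‖τ‖ ≤ 2 * τ.im := by
    have := Complex.norm_le_abs_re_add_abs_im τ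
    rw [abs_of_pos hτ0] at this
    linarith
  have hpow : ‖τ‖ ^ (N + 1) ≤ 2 ^ (N + 1) * (N + 1)! * Real.exp (π * τ.im) := by
    have h1 := Real.pow_div_factorial_le_exp τ.im hτ0.le (N + 1)
    rw [div_le_iff₀ (by positivity)] at h1
    have h2 : Real.exp τ.im ≤ Real.exp (π * τ.im) := by
      rw [Real.exp_le_exp]
      nlinarith [Real.pi_gt_three]
    calc ‖τ‖ ^ (N + 1) ≤ (2 * τ.im) ^ (N + 1) := by gcongr
      _ = 2 ^ (N + 1) * τ.im ^ (N + 1) := mul_pow _ _ _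
      _ ≤ 2 ^ (N + 1) * (Real.exp (π * τ.im) * (N + 1)!) := by
          gcongr
          exact h1.trans (by gcongr)
      _ = _ := by ring
  have hu : ‖(2 * π * Complex.I : ℂ)‖ = 2 * π := by
    simp [abs_of_pos Real.pi_pos]
  rw [BellDepthOne_succ_eq hτ hN hr, laurentP_succ_eq hne, ← mul_sub, sub_sub_sub_cancel_left,
    ← mul_sub, norm_mul, norm_mul, norm_div, norm_div, norm_mul, norm_pow, norm_pow, hu,
    Complex.norm_natCast, Complex.norm_natCast, norm_one, norm_sub_rev]
  have hexp : Real.exp (2 * π * Complex.I * τ).re =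
      Real.exp (-(π * τ.im)) * Real.exp (-(π * τ.im)) := by
    rw [hc, ← Real.exp_add]
    ring_nf
  have hone : Real.exp (π * τ.im) * Real.exp (-(π * τ.im)) = 1 := by
    rw [← Real.exp_add, add_neg_cancel, Real.exp_zero]
  have hmain := h _ hc2
  rw [hexp] at hmain
  calc _ ≤ (2 * π) ^ (r + 1) * (2 ^ (N + 1) * (N + 1)! * Real.exp (π * τ.im)) / (r ! : ℝ) *
        (1 / (N ! : ℝ) * (K * (Real.exp (-(π * τ.im)) * Real.exp (-(π * τ.im))))) := by
        gcongr
    _ = (2 * π) ^ (r + 1) / (r ! : ℝ) * (1 / (N ! : ℝ) * K) * (2 ^ (N + 1) * (N + 1)!) *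
          Real.exp (-(π * τ.im)) * (Real.exp (π * τ.im) * Real.exp (-(π * τ.im))) := by
        ring
    _ ≤ _ := by
        rw [hone, mul_one, add_mul]
        have := Real.exp_pos (-(π * τ.im))
        linarith
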